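/- arXiv:2302.01178 — 2 statements merged into one kernel-verified Lean document; each statement's English description precedes it below -/
import Mathlib

section
/- Let r > σ ≥ 0 with r > 0, let ω : [0,∞) → [0,∞) be monotonically increasing with lim_{y→0+} ω(y) = 0, and let C > 0. Suppose G : H^r(𝕋²) → H^r(𝕋²) satisfies ‖G(a) − G(a')‖_{L²(𝕋²)} ≤ ω(‖a − a'‖_{H^σ(𝕋²)}) for all a, a' ∈ H^r(𝕋²), and ‖G(a)‖_{H^r(𝕋²)} ≤ C‖a‖_{H^r(𝕋²)} for all a ∈ H^r(𝕋²). Then for every ε > 0 and B > 0 there exists w ∈ ℕ such that for all a ∈ H^r(𝕋²) with ‖a‖_{H^r(𝕋²)} ≤ B one has ‖G(a) − P_w(G(P_w a))‖_{L²(𝕋²)} ≤ ε. -/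
open scoped BigOperators

/-- The weight `1 + |k|²` attached to a frequency `k ∈ ℤ^d`. -/
noncomputable def sobWeight {d : ℕ} (k : Fin d → ℤ) : ℝ :=
  1 + ∑ i, ((k i : ℝ)) ^ 2

/-- The Sobolev `H^s`-norm on the torus `𝕋^d`, expressed through the Fourier
coefficients `c : ℤ^d → ℂ` of a function:  `‖f‖_{H^s} = (∑_k (1+|k|²)^s |c_k|²)^{1/2}`.
For `s = 0` this is the `L²`-norm. -/
noncomputable def sobNorm {d : ℕ} (s : ℝ) (c : (Fin d → ℤ) → ℂ) : ℝ :=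
  Real.sqrt (∑' k : Fin d → ℤ, sobWeight k ^ s * ‖c k‖ ^ 2)

/-- Membership in the Sobolev space `H^s(𝕋^d)`, expressed through Fourier coefficients. -/
def MemSobolev {d : ℕ} (s : ℝ) (c : (Fin d → ℤ) → ℂ) : Prop :=
  Summable fun k : Fin d → ℤ => sobWeight k ^ s * ‖c k‖ ^ 2

/-- The orthogonal Fourier projection `P_w`, discarding all Fourier modes `k`
with `|k|_∞ > w`. -/
noncomputable def fourierProj {d : ℕ} (w : ℕ) (c : (Fin d → ℤ) → ℂ) : (Fin d → ℤ) → ℂ :=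
  fun k => if ∀ i, |k i| ≤ (w : ℤ) then c k else 0

theorem one_le_sobWeight {d : ℕ} (k : Fin d → ℤ) : 1 ≤ sobWeight k :=
  le_add_of_nonneg_right (Finset.sum_nonneg fun _ _ => sq_nonneg _)

theorem sobWeight_pos {d : ℕ} (k : Fin d → ℤ) : 0 < sobWeight k :=
  one_pos.trans_le (one_le_sobWeight k)

theorem sobTerm_nonneg {d : ℕ} (s : ℝ) (c : (Fin d → ℤ) → ℂ) (k : Fin d → ℤ) :
    0 ≤ sobWeight k ^ s * ‖c k‖ ^ 2 :=
  mul_nonneg (Real.rpow_nonneg (sobWeight_pos k).le s) (sq_nonneg _)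

theorem sobNorm_nonneg {d : ℕ} (s : ℝ) (c : (Fin d → ℤ) → ℂ) : 0 ≤ sobNorm s c :=
  Real.sqrt_nonneg _

theorem sobNorm_sq {d : ℕ} (s : ℝ) (c : (Fin d → ℤ) → ℂ) :
    sobNorm s c ^ 2 = ∑' k, sobWeight k ^ s * ‖c k‖ ^ 2 :=
  Real.sq_sqrt (tsum_nonneg (sobTerm_nonneg s c))

theorem sobTerm_add_le {d : ℕ} (s : ℝ) (a b : (Fin d → ℤ) → ℂ) (k : Fin d → ℤ) :
    sobWeight k ^ s * ‖(a + b) k‖ ^ 2 ≤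
      2 * (sobWeight k ^ s * ‖a k‖ ^ 2) + 2 * (sobWeight k ^ s * ‖b k‖ ^ 2) := by
  have hsq : ‖(a + b) k‖ ^ 2 ≤ 2 * ‖a k‖ ^ 2 + 2 * ‖b k‖ ^ 2 := by
    have htri : ‖(a + b) k‖ ≤ ‖a k‖ + ‖b k‖ := norm_add_le _ _
    nlinarith [norm_nonneg ((a + b) k), sq_nonneg (‖a k‖ - ‖b k‖)]
  nlinarith [mul_le_mul_of_nonneg_left hsq (Real.rpow_nonneg (sobWeight_pos k).le s)]

theorem MemSobolev.add {d : ℕ} {s : ℝ} {a b : (Fin d → ℤ) → ℂ}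
    (ha : MemSobolev s a) (hb : MemSobolev s b) : MemSobolev s (a + b) :=
  Summable.of_nonneg_of_le (sobTerm_nonneg s _) (sobTerm_add_le s a b)
    ((Summable.mul_left 2 ha).add (Summable.mul_left 2 hb))

theorem MemSobolev.neg {d : ℕ} {s : ℝ} {a : (Fin d → ℤ) → ℂ}
    (ha : MemSobolev s a) : MemSobolev s (-a) := by
  simpa [MemSobolev] using ha

theorem MemSobolev.sub {d : ℕ} {s : ℝ} {a b : (Fin d → ℤ) → ℂ}
    (ha : MemSobolev s a) (hb : MemSobolev s b) : MemSobolev s (a - b) :=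
  sub_eq_add_neg a b ▸ ha.add hb.neg

theorem MemSobolev.mono {d : ℕ} {s r : ℝ} (hsr : s ≤ r) {a : (Fin d → ℤ) → ℂ}
    (ha : MemSobolev r a) : MemSobolev s a :=
  Summable.of_nonneg_of_le (sobTerm_nonneg s a)
    (fun k => mul_le_mul_of_nonneg_right
      (Real.rpow_le_rpow_of_exponent_le (one_le_sobWeight k) hsr) (sq_nonneg _)) ha

theorem sobNorm_add_sq_le {d : ℕ} {s : ℝ} {a b : (Fin d → ℤ) → ℂ}
    (ha : MemSobolev s a) (hb : MemSobolev s b) :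
    sobNorm s (a + b) ^ 2 ≤ 2 * sobNorm s a ^ 2 + 2 * sobNorm s b ^ 2 := by
  have ha' := Summable.mul_left 2 ha
  have hb' := Summable.mul_left 2 hb
  simp only [sobNorm_sq, ← tsum_mul_left]
  rw [← ha'.tsum_add hb']
  exact (ha.add hb).tsum_le_tsum (sobTerm_add_le s a b) (ha'.add hb')

/-- `P_w` preserves `H^s`. -/
theorem MemSobolev.fourierProj {d : ℕ} {s : ℝ} {a : (Fin d → ℤ) → ℂ}
    (ha : MemSobolev s a) (w : ℕ) : MemSobolev s (fourierProj w a) := by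
  refine Summable.of_nonneg_of_le (sobTerm_nonneg s _) (fun k => ?_) ha
  unfold _root_.fourierProj
  split_ifs
  · exact le_rfl
  · simpa using sobTerm_nonneg s a k

theorem sobNorm_fourierProj_le {d : ℕ} {s : ℝ} {a : (Fin d → ℤ) → ℂ}
    (ha : MemSobolev s a) (w : ℕ) : sobNorm s (fourierProj w a) ≤ sobNorm s a := by
  refine Real.sqrt_le_sqrt ((ha.fourierProj w).tsum_le_tsum (fun k => ?_) ha)
  unfold fourierProj
  split_ifs
  · exact le_rfl
  · simpa using sobTerm_nonneg s a k

theorem one_add_le_sobWeight {d : ℕ} {w : ℕ} {k : Fin d → ℤ}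
    (hk : ¬ ∀ i, |k i| ≤ (w : ℤ)) : 1 + (w : ℝ) ≤ sobWeight k := by
  push Not at hk
  obtain ⟨i, hi⟩ := hk
  have hle : ((k i : ℝ)) ^ 2 ≤ ∑ j, ((k j : ℝ)) ^ 2 :=
    Finset.single_le_sum (f := fun j => ((k j : ℝ)) ^ 2) (fun _ _ => sq_nonneg _)
      (Finset.mem_univ i)
  have hw : (w : ℤ) ≤ k i ^ 2 := by
    rw [← sq_abs]
    nlinarith [Int.natCast_nonneg w]
  have hw' : (w : ℝ) ≤ (k i : ℝ) ^ 2 := by exact_mod_cast hw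
  unfold sobWeight
  linarith

/-- The spectral tail of an `H^r` function decays at an algebraic rate in `H^s`, `s ≤ r`. -/
theorem sobNorm_sub_fourierProj_sq_le {d : ℕ} {s r : ℝ} (hsr : s ≤ r)
    {a : (Fin d → ℤ) → ℂ} (ha : MemSobolev r a) (w : ℕ) :
    sobNorm s (a - fourierProj w a) ^ 2 ≤ (1 + (w : ℝ)) ^ (s - r) * sobNorm r a ^ 2 := by
  simp only [sobNorm_sq, ← tsum_mul_left]
  refine ((ha.sub (ha.fourierProj w)).mono hsr).tsum_le_tsum (fun k => ?_)
    (Summable.mul_left _ ha)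
  have hrate : 0 ≤ (1 + (w : ℝ)) ^ (s - r) := by positivity
  by_cases hk : ∀ i, |k i| ≤ (w : ℤ)
  · simpa [fourierProj, hk] using mul_nonneg hrate (sobTerm_nonneg r a k)
  · have hpow : sobWeight k ^ s ≤ (1 + (w : ℝ)) ^ (s - r) * sobWeight k ^ r := by
      calc sobWeight k ^ s = sobWeight k ^ (s - r) * sobWeight k ^ r := by
            rw [← Real.rpow_add (sobWeight_pos k), sub_add_cancel]
        _ ≤ _ := mul_le_mul_of_nonneg_right
            (Real.rpow_le_rpow_of_nonpos (by positivity) (one_add_le_sobWeight hk)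
              (sub_nonpos.2 hsr)) (Real.rpow_nonneg (sobWeight_pos k).le r)
    simpa only [Pi.sub_apply, fourierProj, if_neg hk, sub_zero, mul_assoc] using
      mul_le_mul_of_nonneg_right hpow (sq_nonneg ‖a k‖)

theorem tendsto_one_add_natCast_rpow_mul {t : ℝ} (ht : t < 0) (M : ℝ) :
    Filter.Tendsto (fun w : ℕ => (1 + (w : ℝ)) ^ t * M) Filter.atTop (nhds 0) := by
  have hdecay := tendsto_rpow_neg_atTop (neg_pos.2 ht)
  rw [neg_neg] at hdecay
  simpa using (hdecay.comp
    (Filter.tendsto_atTop_add_const_left _ 1 tendsto_natCast_atTop_atTop)).mul_const M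

/-- An operator `G : H^r(𝕋²) → H^r(𝕋²)` with modulus of continuity `ω` (from `H^σ` to `L²`)
and linear `H^r`-bound can be approximated, uniformly on `H^r`-balls, by
`a ↦ P_w (G (P_w a))`, which maps between spaces of bandlimited functions. -/
theorem bandlimited_approximation
    (r σ : ℝ) (hσ : 0 ≤ σ) (hσr : σ < r) (hr : 0 < r)
    (ω : ℝ → ℝ) (hω_nonneg : ∀ y, 0 ≤ y → 0 ≤ ω y)
    (hω_mono : MonotoneOn ω (Set.Ici 0))
    (hω_lim : Filter.Tendsto ω (nhdsWithin 0 (Set.Ioi 0)) (nhds 0))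
    (C : ℝ) (hC : 0 < C)
    (G : ((Fin 2 → ℤ) → ℂ) → ((Fin 2 → ℤ) → ℂ))
    (hGmem : ∀ a, MemSobolev r a → MemSobolev r (G a))
    (hGmod : ∀ a a', MemSobolev r a → MemSobolev r a' →
      sobNorm 0 (G a - G a') ≤ ω (sobNorm σ (a - a')))
    (hGbdd : ∀ a, MemSobolev r a → sobNorm r (G a) ≤ C * sobNorm r a)
    (ε B : ℝ) (hε : 0 < ε) (hB : 0 < B) :
    ∃ w : ℕ, ∀ a, MemSobolev r a → sobNorm r a ≤ B →
      sobNorm 0 (G a - fourierProj w (G (fourierProj w a))) ≤ ε := by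
  obtain ⟨δ, hδω, hδ⟩ : ∃ δ, ω δ < ε / 2 ∧ 0 < δ :=
    ((hω_lim.eventually_lt_const (half_pos hε)).and self_mem_nhdsWithin).exists
  obtain ⟨w, hwσ, hw0⟩ :=
    (((tendsto_one_add_natCast_rpow_mul (sub_neg.2 hσr) (B ^ 2)).eventually_lt_const
      (pow_pos hδ 2)).and
    ((tendsto_one_add_natCast_rpow_mul (sub_neg.2 hr) ((C * B) ^ 2)).eventually_lt_const
      (pow_pos (half_pos hε) 2))).exists
  refine ⟨w, fun a ha haB => ?_⟩
  have hPa := ha.fourierProj w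
  have hGPa := hGmem _ hPa
  have hinput : sobNorm σ (a - fourierProj w a) ≤ δ := by
    refine le_of_sq_le_sq ((sobNorm_sub_fourierProj_sq_le hσr.le ha w).trans
      (le_trans ?_ hwσ.le)) hδ.le
    have := sobNorm_nonneg r a
    gcongr
  have hcont : sobNorm 0 (G a - G (fourierProj w a)) ≤ ε / 2 :=
    (hGmod _ _ ha hPa).trans
      ((hω_mono (sobNorm_nonneg _ _) hδ.le hinput).trans hδω.le)
  have hGB : sobNorm r (G (fourierProj w a)) ≤ C * B :=
    (hGbdd _ hPa).trans
      (mul_le_mul_of_nonneg_left ((sobNorm_fourierProj_le ha w).trans haB) hC.le)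
  have houtput : sobNorm 0 (G (fourierProj w a) - fourierProj w (G (fourierProj w a))) ^ 2
      ≤ (ε / 2) ^ 2 := by
    refine (sobNorm_sub_fourierProj_sq_le hr.le hGPa w).trans (le_trans ?_ hw0.le)
    have := sobNorm_nonneg r (G (fourierProj w a))
    gcongr
  have hsplit := sobNorm_add_sq_le (((hGmem a ha).sub hGPa).mono hr.le)
    ((hGPa.sub (hGPa.fourierProj w)).mono hr.le)
  rw [sub_add_sub_cancel] at hsplit
  have hcont_sq := pow_le_pow_left₀ (sobNorm_nonneg _ _) hcont 2
  exact le_of_sq_le_sq (by linarith) hε.le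
end

section
/- Let N ∈ ℕ be odd and let f : ℝ → ℂ be a continuous 2π-periodic function. For n ∈ ℤ set x_n = 2πn/N. Then for every x ∈ ℝ, the symmetric limit lim_{M→∞} Σ_{|n|≤M} f(x_n) · sinc(N(x − x_n)/(2π)) exists and equals (1/N) Σ_{|n| ≤ (N−1)/2} Σ_{j=0}^{N−1} f(x_j) exp(i n (x − x_j)). -/
open scoped BigOperators

/-- The normalized sinc function: `sinc x = sin (π x) / (π x)` for `x ≠ 0`, `sinc 0 = 1`. -/
noncomputable def sinc (x : ℝ) : ℝ :=
  if x = 0 then 1 else Real.sin (Real.pi * x) / (Real.pi * x)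

/-- The equispaced node `x_n = 2πn/N`. -/
noncomputable def node (N : ℕ) (n : ℤ) : ℝ := 2 * Real.pi * (n : ℝ) / (N : ℝ)

/-- The trigonometric polynomial interpolant of `f` at the equispaced nodes
`x_j = 2πj/N`, `j = 0, …, N−1` (odd-`N` case):
`P_N f (x) = (1/N) ∑_{|n| ≤ (N−1)/2} ∑_{j=0}^{N−1} f(x_j) exp(i n (x − x_j))`. -/
noncomputable def trigInterp (N : ℕ) (f : ℝ → ℂ) (x : ℝ) : ℂ :=
  (1 / (N : ℂ)) *
    ∑ n ∈ Finset.Icc (-(((N : ℤ) - 1) / 2)) (((N : ℤ) - 1) / 2),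
      ∑ j ∈ Finset.range N,
        f (node N j) * Complex.exp (Complex.I * (n : ℂ) * ((x : ℂ) - (node N j : ℂ)))

/-- The symmetric partial sums `∑_{|n| ≤ M} f(x_n) sinc (N (x − x_n) / (2π))` of the
sinc interpolation series. -/
noncomputable def sincPartial (N : ℕ) (f : ℝ → ℂ) (x : ℝ) (M : ℕ) : ℂ :=
  ∑ n ∈ Finset.Icc (-(M : ℤ)) (M : ℤ),
    ((sinc ((N : ℝ) * (x - node N n) / (2 * Real.pi)) : ℝ) : ℂ) * f (node N n)

open Filter Topology Finset

/-- The partial fraction expansion of `π / sin (π s)`, with opposite poles paired. -/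
lemma hasSum_alternating_cotTerm {s : ℂ} (hs : s ∈ Complex.integerComplement) :
    HasSum (fun n : ℕ => (-1) ^ (n + 1) * cotTerm s n)
      (Real.pi / Complex.sin (Real.pi * s) - 1 / s) := by
  have hs2 : s / 2 ∈ Complex.integerComplement := by
    rintro ⟨k, hk⟩
    exact hs ⟨2 * k, by push_cast; rw [hk]; ring⟩
  have hs0 := Complex.integerComplement.ne_zero hs
  have htot : HasSum (cotTerm s) (Real.pi * Complex.cot (Real.pi * s) - 1 / s) := by
    rw [cot_series_rep' hs]
    exact (summable_cotTerm hs).hasSum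
  have hodd : HasSum (fun m : ℕ => cotTerm s (2 * m + 1))
      ((Real.pi * Complex.cot (Real.pi * (s / 2)) - 1 / (s / 2)) / 2) := by
    rw [cot_series_rep' hs2]
    refine ((summable_cotTerm hs2).hasSum.div_const 2).congr_fun fun m => ?_
    simp only [cotTerm]
    have h (y : ℂ) : 1 / (s / 2 + y) = 2 * (1 / (s + 2 * y)) := by
      rw [show s / 2 + y = (s + 2 * y) / 2 by ring, one_div_div]
      ring
    rw [sub_eq_add_neg (s / 2), h, h]
    push_cast
    ring_nf
  have heven : HasSum (fun m : ℕ => cotTerm s (2 * m))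
      (Real.pi * Complex.cot (Real.pi * s) - 1 / s -
        (Real.pi * Complex.cot (Real.pi * (s / 2)) - 1 / (s / 2)) / 2) := by
    have hsum : Summable fun m : ℕ => cotTerm s (2 * m) :=
      (summable_cotTerm hs).comp_injective fun a b h => by simpa using h
    have := (hsum.hasSum.even_add_odd hodd).unique htot
    rw [← this, add_sub_cancel_right]
    exact hsum.hasSum
  have key := HasSum.even_add_odd (f := fun n : ℕ => (-1) ^ (n + 1) * cotTerm s n)
    (heven.neg.congr_fun fun m => by simp [pow_succ, pow_mul])
    (hodd.congr_fun fun m => by simp [pow_succ, pow_mul])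
  convert key using 1
  have h1 := sin_pi_mul_ne_zero hs
  have h2 := sin_pi_mul_ne_zero hs2
  have hz : (Real.pi : ℂ) * s = 2 * (Real.pi * (s / 2)) := by ring
  have hcot : 1 / Complex.sin (Real.pi * s) =
      Complex.cot (Real.pi * (s / 2)) - Complex.cot (Real.pi * s) := by
    rw [hz] at h1 ⊢
    generalize (Real.pi : ℂ) * (s / 2) = z at *
    have h3 : Complex.cos z ≠ 0 := fun h => h1 (by rw [Complex.sin_two_mul, h, mul_zero])
    rw [Complex.cot_eq_cos_div_sin, Complex.cot_eq_cos_div_sin, Complex.sin_two_mul,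
      Complex.cos_two_mul]
    field_simp
    ring
  rw [div_eq_mul_one_div, hcot]
  field_simp
  ring

lemma sum_Icc_alternating_eq (s : ℂ) (K : ℕ) :
    ∑ k ∈ Icc (-(K : ℤ)) K, (-1 : ℂ) ^ k * (1 / (s - k)) =
      1 / s + ∑ n ∈ range K, (-1) ^ (n + 1) * cotTerm s n := by
  induction K with
  | zero => simp
  | succ K ih =>
    rw [sum_range_succ, Nat.cast_succ, sum_Icc_succ_eq_add_endpoints, ih, zpow_neg, ← inv_zpow]
    have : (-1 : ℂ) ^ ((K : ℤ) + 1) = (-1) ^ (K + 1) := by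
      exact_mod_cast zpow_natCast (-1 : ℂ) (K + 1)
    rw [inv_neg_one, this]
    simp only [cotTerm]
    push_cast
    ring

/-- The closed form of the Dirichlet kernel. -/
lemma sin_mul_sum_exp (r : ℕ) (z : ℂ) :
    Complex.sin z * ∑ n ∈ Icc (-(r : ℤ)) r, Complex.exp (Complex.I * n * (2 * z)) =
      Complex.sin ((2 * r + 1) * z) := by
  induction r with
  | zero => simp
  | succ r ih =>
    rw [Nat.cast_succ, sum_Icc_succ_eq_add_endpoints, mul_add, ih]
    have h : Complex.exp (Complex.I * (((r : ℤ) + 1 : ℤ) : ℂ) * (2 * z)) +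
        Complex.exp (Complex.I * ((-((r : ℤ) + 1) : ℤ) : ℂ) * (2 * z)) =
        2 * Complex.cos ((2 * r + 2) * z) := by
      rw [Complex.two_cos]
      push_cast
      ring_nf
    rw [h, show ((2 * ((r + 1 : ℕ) : ℂ) + 1) * z) = (2 * r + 2) * z + z by push_cast; ring,
      show (2 * (r : ℂ) + 1) * z = (2 * r + 2) * z - z by ring, Complex.sin_add, Complex.sin_sub]
    ring

lemma sinc_intCast (m : ℤ) : sinc m = if m = 0 then 1 else 0 := by
  by_cases h : m = 0
  · simp [sinc, h]
  · simp [sinc, h, mul_comm Real.pi, Real.sin_int_mul_pi]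

/-- Summing `sinc` over translates by an odd integer `2 r + 1` gives the normalized Dirichlet
kernel. -/
lemma tendsto_sum_sinc_dirichlet (r : ℕ) (s : ℝ) :
    Tendsto (fun K : ℕ => ∑ k ∈ Icc (-(K : ℤ)) K, ((sinc ((2 * r + 1) * (s - k)) : ℝ) : ℂ))
      atTop (𝓝 (1 / (2 * r + 1) *
        ∑ n ∈ Icc (-(r : ℤ)) r, Complex.exp (Complex.I * n * (2 * (Real.pi * s))))) := by
  have hN : (2 * r + 1 : ℂ) ≠ 0 := by exact_mod_cast (2 * r).succ_ne_zero
  have hNR : (2 * r + 1 : ℝ) ≠ 0 := by positivity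
  by_cases hs : (s : ℂ) ∈ Complex.integerComplement
  · have hsin := sin_pi_mul_ne_zero hs
    have hs0 := Complex.integerComplement.ne_zero hs
    have hlim : Tendsto (fun K : ℕ => Complex.sin ((2 * r + 1) * (Real.pi * s)) /
        (Real.pi * (2 * r + 1)) * ∑ k ∈ Icc (-(K : ℤ)) K, (-1 : ℂ) ^ k * (1 / ((s : ℂ) - k)))
        atTop (𝓝 (Complex.sin ((2 * r + 1) * (Real.pi * s)) / (Real.pi * (2 * r + 1)) *
          (1 / s + (Real.pi / Complex.sin (Real.pi * s) - 1 / s)))) := by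
      simp_rw [sum_Icc_alternating_eq]
      exact ((hasSum_alternating_cotTerm hs).tendsto_sum_nat.const_add _).const_mul _
    convert hlim using 1
    · ext K
      rw [mul_sum]
      refine sum_congr rfl fun k _ => ?_
      have hk : (s : ℂ) - k ≠ 0 := by
        simpa [sub_eq_add_neg] using Complex.integerComplement_add_ne_zero hs (-k)
      have hkR : s - k ≠ 0 := by exact_mod_cast hk
      have harg : Real.pi * ((2 * r + 1) * (s - k)) =
          (2 * r + 1) * (Real.pi * s) - ((2 * r + 1) * k : ℤ) * Real.pi := by
        push_cast
        ring
      have hpow : (-1 : ℝ) ^ ((2 * r + 1) * k : ℤ) = (-1) ^ k := by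
        rw [zpow_mul, Odd.neg_one_zpow ⟨r, rfl⟩]
      rw [sinc, if_neg (mul_ne_zero hNR hkR)]
      nth_rewrite 1 [harg]
      rw [Real.sin_sub_int_mul_pi, hpow]
      push_cast
      field_simp
    · congr 1
      rw [← sin_mul_sum_exp]
      generalize ∑ n ∈ Icc (-(r : ℤ)) r, Complex.exp _ = D
      field_simp
      ring
  · obtain ⟨m, hm⟩ := not_not.mp hs
    have hm' : s = m := by exact_mod_cast hm.symm
    subst hm'
    have hker : (1 / (2 * r + 1) : ℂ) * ∑ n ∈ Icc (-(r : ℤ)) r,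
        Complex.exp (Complex.I * n * (2 * (Real.pi * ((m : ℝ) : ℂ)))) = 1 := by
      have h (n : ℤ) : Complex.exp (Complex.I * n * (2 * (Real.pi * ((m : ℝ) : ℂ)))) = 1 :=
        Complex.exp_eq_one_iff.mpr ⟨n * m, by push_cast; ring⟩
      simp only [h, sum_const, Int.card_Icc, nsmul_eq_mul, mul_one]
      rw [show ((r : ℤ) + 1 - -r).toNat = 2 * r + 1 by omega]
      push_cast
      field_simp
    rw [hker]
    refine tendsto_const_nhds.congr' ?_
    filter_upwards [eventually_ge_atTop m.natAbs] with K hK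
    have hterm (k : ℤ) : sinc ((2 * r + 1) * ((m : ℝ) - k)) = if k = m then 1 else 0 := by
      have := sinc_intCast ((2 * r + 1) * (m - k))
      push_cast at this
      rw [this]
      have h2 : (2 * r + 1 : ℤ) ≠ 0 := by omega
      simp [h2, sub_eq_zero, eq_comm]
    simp_rw [hterm]
    rw [sum_eq_single_of_mem m (by simp; omega) (by simp +contextual)]
    simp

lemma tendsto_sinc_cobounded : Tendsto sinc (Bornology.cobounded ℝ) (𝓝 0) := by
  have h := (tendsto_inv₀_cobounded (α := ℝ)).norm
  rw [norm_zero] at h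
  refine squeeze_zero_norm' ?_ h
  filter_upwards [Bornology.eventually_ne_cobounded (0 : ℝ)] with y hy
  rw [sinc, if_neg hy, norm_div, norm_mul, norm_inv, ← one_div]
  have h1 : ‖Real.sin (Real.pi * y)‖ ≤ 1 := Real.abs_sin_le_one _
  have h2 : ‖y‖ ≤ ‖Real.pi‖ * ‖y‖ := by
    rw [Real.norm_of_nonneg Real.pi_pos.le]
    nlinarith [norm_nonneg y, Real.pi_gt_three]
  have h3 : 0 < ‖y‖ := norm_pos_iff.mpr hy
  gcongr

/-- A sequence with vanishing increments converges as soon as it converges along an arithmetic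
progression. -/
lemma tendsto_of_tendsto_arithmetic_progression {u : ℕ → ℂ} {L : ℂ} {N r : ℕ} (hN : 0 < N)
    (hstep : Tendsto (fun M => u (M + 1) - u M) atTop (𝓝 0))
    (hsub : Tendsto (fun K => u (K * N + r)) atTop (𝓝 L)) :
    Tendsto u atTop (𝓝 L) := by
  have hmul : Tendsto (fun K => K * N) atTop atTop := tendsto_id.atTop_mul_const' hN
  have hshift (i : ℕ) : Tendsto (fun K => u (K * N + r + i)) atTop (𝓝 L) := by
    induction i with
    | zero => exact hsub
    | succ i ih =>
      have h := ih.add (hstep.comp (tendsto_atTop_mono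
        (fun K => (by omega : K * N ≤ K * N + r + i)) hmul))
      simpa [Function.comp_def, ← add_assoc] using h
  refine tendsto_def.mpr fun s hs => ?_
  have hall : ∀ᶠ K in atTop, ∀ i ∈ range N, u (K * N + r + i) ∈ s :=
    (eventually_all_finset _).mpr fun i _ => hshift i hs
  have hdiv : Tendsto (fun M => (M - r) / N) atTop atTop :=
    (Nat.tendsto_div_const_atTop hN.ne').comp (tendsto_sub_atTop_nat r)
  filter_upwards [hdiv.eventually hall, eventually_ge_atTop r] with M hM hr
  have h := hM ((M - r) % N) (mem_range.mpr (Nat.mod_lt _ hN))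
  have hdm := Nat.div_add_mod' (M - r) N
  rwa [show (M - r) / N * N + r + (M - r) % N = M by omega] at h

lemma sum_Icc_eq_sum_residues (F : ℤ → ℂ) (r K : ℕ) :
    ∑ n ∈ Icc (-((K * (2 * r + 1) + r : ℕ) : ℤ)) ((K * (2 * r + 1) + r : ℕ) : ℤ), F n =
      ∑ j ∈ Icc (-(r : ℤ)) r, ∑ k ∈ Icc (-(K : ℤ)) K, F (j + k * (2 * r + 1)) := by
  rw [← sum_product']
  symm
  have hpos : (0 : ℤ) < 2 * r + 1 := by omega
  refine sum_nbij' (fun p => p.1 + p.2 * (2 * r + 1))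
    (fun n => ((n + r) % (2 * r + 1) - r, (n + r) / (2 * r + 1))) ?_ ?_ ?_ ?_ ?_
  · rintro ⟨j, k⟩ h
    simp only [mem_product, mem_Icc] at h ⊢
    push_cast
    constructor <;> nlinarith
  · intro n h
    simp only [mem_product, mem_Icc] at h ⊢
    push_cast at h
    have h1 := Int.emod_nonneg (n + r) hpos.ne'
    have h2 := Int.emod_lt_of_pos (n + r) hpos
    refine ⟨⟨by omega, by omega⟩, ?_, ?_⟩
    · rw [Int.le_ediv_iff_mul_le hpos]
      linarith
    · rw [← Int.lt_add_one_iff, Int.ediv_lt_iff_lt_mul hpos]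
      linarith
  · rintro ⟨j, k⟩ h
    simp only [mem_product, mem_Icc] at h
    have h1 : j + k * (2 * r + 1) + r = (j + r) + k * (2 * r + 1) := by ring
    have h2 : 0 ≤ j + r := by omega
    have h3 : j + r < 2 * r + 1 := by omega
    simp only [h1, Int.add_mul_emod_self_right, Int.emod_eq_of_lt h2 h3,
      Int.add_mul_ediv_right _ _ hpos.ne', Int.ediv_eq_zero_of_lt h2 h3]
    simp
  · intro n _
    have := Int.emod_add_ediv_mul (n + r) (2 * r + 1)
    simp only
    linarith
  · simp

lemma sum_Icc_eq_sum_range_of_periodic {F : ℤ → ℂ} (r : ℕ)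
    (hF : ∀ j, F (j + (2 * r + 1)) = F j) :
    ∑ j ∈ Icc (-(r : ℤ)) r, F j = ∑ j ∈ range (2 * r + 1), F j := by
  refine sum_nbij' (fun j => (if 0 ≤ j then j else j + (2 * r + 1)).toNat)
    (fun j => if j ≤ r then (j : ℤ) else j - (2 * r + 1)) ?_ ?_ ?_ ?_ ?_
  · intro j h
    simp only [mem_Icc, mem_range] at h ⊢
    split_ifs <;> omega
  · intro j h
    simp only [mem_Icc, mem_range] at h ⊢
    split_ifs <;> omega
  · intro j h
    simp only [mem_Icc] at h
    split_ifs <;> omega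
  · intro j h
    simp only [mem_range] at h
    split_ifs <;> omega
  · intro j h
    simp only [mem_Icc] at h
    split_ifs with h0
    · rw [Int.toNat_of_nonneg h0]
    · rw [Int.toNat_of_nonneg (by omega), hF]

lemma apply_node_add_mul {N : ℕ} (hN : N ≠ 0) {f : ℝ → ℂ}
    (hper : Function.Periodic f (2 * Real.pi)) (j k : ℤ) :
    f (node N (j + k * N)) = f (node N j) := by
  have hN' : (N : ℝ) ≠ 0 := by exact_mod_cast hN
  have : node N (j + k * N) = node N j + k * (2 * Real.pi) := by
    simp only [node]
    push_cast
    field_simp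
  rw [this]
  exact hper.int_mul k _

lemma tendsto_sincPartial_succ_sub {N : ℕ} (hN : N ≠ 0) {f : ℝ → ℂ}
    (hf : Continuous f) (hper : Function.Periodic f (2 * Real.pi)) (x : ℝ) :
    Tendsto (fun M => sincPartial N f x (M + 1) - sincPartial N f x M) atTop (𝓝 0) := by
  have hN' : (N : ℝ) ≠ 0 := by exact_mod_cast hN
  obtain ⟨C, hC⟩ := (hper.isBounded_of_continuous (by positivity) hf).exists_norm_le
  have harg (n : ℤ) : (N : ℝ) * (x - node N n) / (2 * Real.pi) = N * x / (2 * Real.pi) - n := by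
    simp only [node]
    field_simp
  have hterm {g : ℕ → ℤ} (hg : Tendsto (fun M => N * x / (2 * Real.pi) - (g M : ℝ)) atTop
      (Bornology.cobounded ℝ)) : Tendsto (fun M =>
      ((sinc ((N : ℝ) * (x - node N (g M)) / (2 * Real.pi)) : ℝ) : ℂ) * f (node N (g M)))
      atTop (𝓝 0) := by
    refine Tendsto.zero_mul_isBoundedUnder_le ?_
      (isBoundedUnder_of ⟨C, fun M => hC _ (Set.mem_range_self _)⟩)
    simp_rw [harg]
    exact_mod_cast (Complex.continuous_ofReal.tendsto 0).comp (tendsto_sinc_cobounded.comp hg)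
  have hcast : Tendsto (fun M : ℕ => (M : ℝ) + 1) atTop atTop :=
    tendsto_atTop_add_const_right _ 1 tendsto_natCast_atTop_atTop
  have hpos := hterm (g := fun M => M + 1) (by
    push_cast
    exact (tendsto_const_nhds.add_atBot (tendsto_neg_atTop_atBot.comp hcast)).mono_right
      IsOrderBornology.atBot_le_cobounded)
  have hneg := hterm (g := fun M => -(M + 1)) (by
    push_cast
    simp only [sub_neg_eq_add]
    exact (tendsto_const_nhds.add_atTop hcast).mono_right IsOrderBornology.atTop_le_cobounded)
  have h := hpos.add hneg
  rw [add_zero] at h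
  refine h.congr fun M => ?_
  simp only [sincPartial]
  rw [Nat.cast_succ, sum_Icc_succ_eq_add_endpoints, add_sub_cancel_right]

/-- For odd `N` and a continuous `2π`-periodic `f`, the symmetric sinc interpolation series
converges at every point to the trigonometric polynomial interpolant of `f`. -/
theorem sinc_series_eq_trigInterp (N : ℕ) (hN : Odd N) (f : ℝ → ℂ)
    (hf : Continuous f) (hper : Function.Periodic f (2 * Real.pi)) (x : ℝ) :
    Filter.Tendsto (sincPartial N f x) Filter.atTop (nhds (trigInterp N f x)) := by
  obtain ⟨r, rfl⟩ := hN
  refine tendsto_of_tendsto_arithmetic_progression (Nat.succ_pos (2 * r))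
    (tendsto_sincPartial_succ_sub (Nat.succ_ne_zero _) hf hper x) (r := r) ?_
  have hN : (2 * r + 1 : ℝ) ≠ 0 := by positivity
  have hlim := tendsto_finsetSum (Icc (-(r : ℤ)) r) fun j _ =>
    (tendsto_sum_sinc_dirichlet r ((x - node (2 * r + 1) j) / (2 * Real.pi))).mul_const
      (f (node (2 * r + 1) j))
  convert hlim using 1
  · ext K
    rw [sincPartial, sum_Icc_eq_sum_residues]
    refine sum_congr rfl fun j _ => ?_
    rw [sum_mul]
    refine sum_congr rfl fun k _ => ?_
    have hnode := apply_node_add_mul (N := 2 * r + 1) (Nat.succ_ne_zero _) hper j k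
    push_cast at hnode
    rw [hnode]
    congr 3
    simp only [node]
    push_cast
    field_simp
    ring
  · congr 1
    rw [sum_Icc_eq_sum_range_of_periodic, trigInterp, sum_comm, mul_sum]
    · refine sum_congr rfl fun j _ => ?_
      rw [show (((2 * r + 1 : ℕ) : ℤ) - 1) / 2 = r by push_cast; omega, mul_sum, mul_sum, sum_mul]
      refine sum_congr rfl fun n _ => ?_
      have : (2 * (Real.pi * (((x - node (2 * r + 1) j) / (2 * Real.pi) : ℝ) : ℂ))) =
          (x : ℂ) - node (2 * r + 1) j := by
        push_cast
        field_simp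
      rw [this]
      push_cast
      ring
    · intro j
      have hnode := apply_node_add_mul (N := 2 * r + 1) (Nat.succ_ne_zero _) hper j 1
      push_cast at hnode
      rw [one_mul] at hnode
      rw [hnode]
      congr 2
      refine sum_congr rfl fun n _ => ?_
      refine Complex.exp_eq_exp_iff_exists_int.mpr ⟨-n, ?_⟩
      have hNC : (2 * r + 1 : ℂ) ≠ 0 := by exact_mod_cast hN
      have hpi : (Real.pi : ℂ) ≠ 0 := by exact_mod_cast Real.pi_ne_zero
      simp only [node]
      push_cast
      field_simp
      ring
end
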